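/- For every complete finitely ambiguous NBW A over Σ with n states, there exists a limit deterministic NBW B over Σ with at most 2^n + 4^n states such that L(B) = Σ^ω ∖ L(A). -/

import Mathlib

open scoped Classical

/-- A nondeterministic Büchi automaton on ω-words with states `Q` over alphabet `σ`. -/
structure NBW (σ : Type) (Q : Type) where
  init : Set Q
  trans : Q → σ → Set Q
  acc : Set Q

namespace NBW

variable {σ Q : Type}

/-- `ρ` is a run of `A` on the ω-word `w`. -/
def IsRun (A : NBW σ Q) (w : ℕ → σ) (ρ : ℕ → Q) : Prop :=
  ρ 0 ∈ A.init ∧ ∀ i, ρ (i + 1) ∈ A.trans (ρ i) (w i)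

/-- `ρ` is an accepting run of `A` on `w`: it visits `A.acc` infinitely often. -/
def IsAccRun (A : NBW σ Q) (w : ℕ → σ) (ρ : ℕ → Q) : Prop :=
  A.IsRun w ρ ∧ ∀ n, ∃ m, n ≤ m ∧ ρ m ∈ A.acc

/-- The ω-language accepted by `A`. -/
def Lang (A : NBW σ Q) : Set (ℕ → σ) := {w | ∃ ρ, A.IsAccRun w ρ}

/-- `A` is complete: every state has a successor on every letter. -/
def Complete (A : NBW σ Q) : Prop := ∀ q a, (A.trans q a).Nonempty

/-- `A` is finitely ambiguous: every accepted word has finitely many accepting runs. -/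
def FinitelyAmbiguous (A : NBW σ Q) : Prop :=
  ∀ w ∈ A.Lang, {ρ | A.IsAccRun w ρ}.Finite

/-- `A` is limit deterministic with partition `(QN, QD)`. -/
def LimitDetPart (A : NBW σ Q) (QN QD : Set Q) : Prop :=
  Disjoint QN QD ∧ QN ∪ QD = Set.univ ∧ A.acc ⊆ QD ∧
    ∀ q ∈ QD, ∀ a, ∃ q' ∈ QD, A.trans q a = {q'}

/-- `A` is limit deterministic (for some partition). -/
def LimitDet (A : NBW σ Q) : Prop := ∃ QN QD, A.LimitDetPart QN QD

end NBW

namespace NBW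

variable {σ Q : Type}

/-- Successor set. -/
def post (A : NBW σ Q) (S : Set Q) (a : σ) : Set Q := {q' | ∃ q ∈ S, q' ∈ A.trans q a}

/-- A chosen predecessor of `q'` inside `S`. -/
noncomputable def prd (A : NBW σ Q) (S : Set Q) (a : σ) (q' : Q) : Q :=
  if h : ∃ q ∈ S, q' ∈ A.trans q a then h.choose else q'

theorem prd_spec (A : NBW σ Q) {S : Set Q} {a : σ} {q' : Q} (h : q' ∈ A.post S a) :
    A.prd S a q' ∈ S ∧ q' ∈ A.trans (A.prd S a q') a := by
  have h' : ∃ q ∈ S, q' ∈ A.trans q a := h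
  unfold prd
  rw [dif_pos h']
  exact h'.choose_spec

/-- Reachable sets along `w`. -/
def rch (A : NBW σ Q) (w : ℕ → σ) : ℕ → Set Q
  | 0 => A.init
  | l + 1 => A.post (rch A w l) (w l)

/-- Chosen predecessor along `w`. -/
noncomputable def pw (A : NBW σ Q) (w : ℕ → σ) (l : ℕ) (q : Q) : Q :=
  A.prd (A.rch w l) (w l) q

theorem pw_spec (A : NBW σ Q) {w : ℕ → σ} {l : ℕ} {q : Q} (h : q ∈ A.rch w (l + 1)) :
    A.pw w l q ∈ A.rch w l ∧ q ∈ A.trans (A.pw w l q) (w l) :=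
  A.prd_spec h

theorem run_mem_rch (A : NBW σ Q) {w : ℕ → σ} {ρ : ℕ → Q} (h : A.IsRun w ρ) (l : ℕ) :
    ρ l ∈ A.rch w l := by
  induction l with
  | zero => exact h.1
  | succ l ih => exact ⟨_, ih, h.2 l⟩

theorem rch_prefix (A : NBW σ Q) (w : ℕ → σ) (l : ℕ) : ∀ q ∈ A.rch w l,
    ∃ η : ℕ → Q, η 0 ∈ A.init ∧ (∀ i < l, η (i + 1) ∈ A.trans (η i) (w i)) ∧ η l = q := by
  induction l with
  | zero => exact fun q hq => ⟨fun _ => q, hq, by simp, rfl⟩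
  | succ l ih =>
    rintro q ⟨r, hr, hq⟩
    obtain ⟨η, h0, h1, h2⟩ := ih r hr
    refine ⟨fun i => if i ≤ l then η i else q, by simpa using h0, ?_, by simp⟩
    intro i hi
    rcases Nat.lt_or_ge i l with h | h
    · have h3 : i + 1 ≤ l := h
      simpa [h.le, h3] using h1 i h
    · obtain rfl : i = l := by omega
      simpa [h2] using hq

/-- Glue a reachable vertex with a path from it. -/
theorem glue (A : NBW σ Q) {w : ℕ → σ} {l : ℕ} {q : Q} (hq : q ∈ A.rch w l) (τ : ℕ → Q)
    (h0 : τ l = q) (hτ : ∀ i, l ≤ i → τ (i + 1) ∈ A.trans (τ i) (w i)) :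
    ∃ η, A.IsRun w η ∧ ∀ i, l ≤ i → η i = τ i := by
  obtain ⟨η, e0, e1, e2⟩ := A.rch_prefix w l q hq
  have key : ∀ i, l ≤ i → (if i ≤ l then η i else τ i) = τ i := by
    intro i hi
    split_ifs with h
    · obtain rfl : i = l := by omega
      rw [e2, h0]
    · rfl
  refine ⟨fun i => if i ≤ l then η i else τ i, ⟨by simpa using e0, ?_⟩, key⟩
  intro i
  rcases Nat.lt_or_ge i l with h | h
  · have h3 : i + 1 ≤ l := h
    simpa [h.le, h3] using e1 i h
  · show (if i + 1 ≤ l then η (i+1) else τ (i+1)) ∈ A.trans (if i ≤ l then η i else τ i) (w i)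
    rw [key i h, key (i+1) (by omega)]
    exact hτ i h

theorem ev_prd (A : NBW σ Q) (hfa : A.FinitelyAmbiguous) {w : ℕ → σ} {ρ : ℕ → Q}
    (h : A.IsAccRun w ρ) : ∃ K, ∀ l, K ≤ l → A.pw w l (ρ (l + 1)) = ρ l := by
  by_contra hcon
  push Not at hcon
  have hinf : {l | A.pw w l (ρ (l + 1)) ≠ ρ l}.Infinite := by
    rw [Set.infinite_iff_exists_gt]
    intro a
    obtain ⟨l, hl, hl'⟩ := hcon (a + 1)
    exact ⟨l, hl', by omega⟩
  have hex : ∀ l, A.pw w l (ρ (l + 1)) ≠ ρ l →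
      ∃ η, A.IsAccRun w η ∧ η l ≠ ρ l ∧ ∀ i, l < i → η i = ρ i := by
    intro l hl
    have hs := A.pw_spec (A.run_mem_rch h.1 (l + 1))
    obtain ⟨η, hη, he⟩ := A.glue hs.1
      (fun i => if i = l then A.pw w l (ρ (l + 1)) else ρ i) (by simp) (by
        intro i hi
        rcases eq_or_ne i l with rfl | hne
        · simpa using hs.2
        · have : i + 1 ≠ l := by omega
          simpa [hne, this] using h.1.2 i)
    have he' : ∀ i, l < i → η i = ρ i := by
      intro i hi
      have : i ≠ l := by omega
      simpa [this] using he i hi.le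
    refine ⟨η, ⟨hη, ?_⟩, ?_, he'⟩
    · intro n
      obtain ⟨m, hm, hm'⟩ := h.2 (max n (l + 1))
      refine ⟨m, by omega, ?_⟩
      rw [he' m (by omega)]
      exact hm'
    · have := he l le_rfl
      simp only [if_true] at this
      rw [this]
      exact hl
  have : Nonempty Q := ⟨ρ 0⟩
  choose! η h1 h2 h3 using hex
  have hinj : Set.InjOn η {l | A.pw w l (ρ (l + 1)) ≠ ρ l} := by
    intro a ha b hb hab
    by_contra hne
    rcases lt_or_gt_of_ne hne with hlt | hlt
    · exact h2 b hb (by rw [← hab]; exact h3 a ha b hlt)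
    · exact h2 a ha (by rw [hab]; exact h3 b hb a hlt)
  exact (Set.infinite_of_injOn_mapsTo hinj (fun l hl => h1 l hl) hinf) (hfa w ⟨ρ, h⟩)

theorem sound (A : NBW σ Q) (hfa : A.FinitelyAmbiguous) {w : ℕ → σ} {k : ℕ} {C B : ℕ → Set Q}
    (hC : ∀ l, k ≤ l → C (l + 1) = {q | q ∈ A.rch w (l + 1) ∧ (A.pw w l q ∈ C l ∨ q ∈ A.acc)})
    (hB : ∀ l, k ≤ l → B (l + 1) = if B l = ∅ then C (l + 1) else
      {q | q ∈ A.rch w (l + 1) ∧ A.pw w l q ∈ B l})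
    (hinf : ∀ n, ∃ m, n ≤ m ∧ B m = ∅) : w ∉ A.Lang := by
  rintro ⟨ρ, hρ⟩
  obtain ⟨K, hK⟩ := A.ev_prd hfa hρ
  obtain ⟨m, hm, hmF⟩ := hρ.2 (max K k + 1)
  have hr := A.run_mem_rch hρ.1
  have hCm : ∀ l, m ≤ l → ρ l ∈ C l := by
    intro l hl
    induction l, hl using Nat.le_induction with
    | base =>
      obtain ⟨m', rfl⟩ : ∃ m', m = m' + 1 := ⟨m - 1, by omega⟩
      rw [hC m' (by omega)]
      exact ⟨hr _, Or.inr hmF⟩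
    | succ l hl ih =>
      rw [hC l (by omega)]
      exact ⟨hr _, Or.inl (by rw [hK l (by omega)]; exact ih)⟩
  obtain ⟨l0, hl0, hB0⟩ := hinf m
  have hBm : ∀ l, l0 + 1 ≤ l → ρ l ∈ B l := by
    intro l hl
    induction l, hl using Nat.le_induction with
    | base =>
      rw [hB l0 (by omega), if_pos hB0]
      exact hCm _ (by omega)
    | succ l hl ih =>
      rw [hB l (by omega), if_neg (Set.nonempty_iff_ne_empty.1 ⟨_, ih⟩)]
      exact ⟨hr _, by rw [hK l (by omega)]; exact ih⟩
  obtain ⟨l1, hl1, hB1⟩ := hinf (l0 + 1)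
  have := hBm l1 hl1
  rw [hB1] at this
  exact this

/-- Vertices at level `l` having a descendant `j` levels later in the reduced forest. -/
noncomputable def img (A : NBW σ Q) (w : ℕ → σ) : ℕ → ℕ → Set Q
  | 0, l => A.rch w l
  | j + 1, l => A.pw w l '' img A w j (l + 1)

theorem img_succ_subset (A : NBW σ Q) (w : ℕ → σ) (j : ℕ) :
    ∀ l, A.img w (j + 1) l ⊆ A.img w j l := by
  induction j with
  | zero =>
    rintro l _ ⟨q, hq, rfl⟩
    exact (A.pw_spec hq).1
  | succ j ih =>
    intro l
    exact Set.image_mono (ih (l + 1))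

theorem img_anti (A : NBW σ Q) (w : ℕ → σ) (l : ℕ) : Antitone (fun j => A.img w j l) :=
  antitone_nat_of_succ_le fun j => A.img_succ_subset w j l

/-- Vertices with infinitely many descendants. -/
noncomputable def tt (A : NBW σ Q) (w : ℕ → σ) (l : ℕ) : Set Q := ⋂ j, A.img w j l

theorem tt_stable [Fintype Q] (A : NBW σ Q) (w : ℕ → σ) (l : ℕ) :
    ∃ J, A.img w J l ⊆ A.tt w l := by
  have : ∀ q, ∃ j, q ∉ A.tt w l → q ∉ A.img w j l := by
    intro q
    by_cases h : q ∈ A.tt w l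
    · exact ⟨0, fun h' => absurd h h'⟩
    · have h' := h
      simp only [tt, Set.mem_iInter, not_forall] at h'
      obtain ⟨j, hj⟩ := h'
      exact ⟨j, fun _ => hj⟩
  choose j hj using this
  refine ⟨Finset.univ.sup j, fun q hq => ?_⟩
  by_contra hn
  exact hj q hn (A.img_anti w l (Finset.le_sup (Finset.mem_univ q)) hq)

theorem tt_sub (A : NBW σ Q) (w : ℕ → σ) (l : ℕ) : A.tt w l ⊆ A.rch w l :=
  Set.iInter_subset (fun j => A.img w j l) 0

theorem tt_image [Fintype Q] (A : NBW σ Q) (w : ℕ → σ) (l : ℕ) :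
    A.pw w l '' A.tt w (l + 1) = A.tt w l := by
  apply Set.Subset.antisymm
  · rintro _ ⟨q, hq, rfl⟩
    refine Set.mem_iInter.2 fun j => A.img_succ_subset w j l ?_
    exact ⟨q, Set.mem_iInter.1 hq j, rfl⟩
  · intro q hq
    obtain ⟨J, hJ⟩ := A.tt_stable w (l + 1)
    obtain ⟨x, hx, rfl⟩ := Set.mem_iInter.1 hq (J + 1)
    exact ⟨x, hJ hx, rfl⟩

theorem ev_const (f : ℕ → ℕ) (hf : Monotone f) (N : ℕ) (hN : ∀ i, f i ≤ N) :
    ∃ K, ∀ l, K ≤ l → f l = f K := by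
  obtain ⟨K, hK⟩ : ∃ K, ∀ l, f l ≤ f K := by
    have hb : BddAbove (Set.range f) := ⟨N, by rintro _ ⟨i, rfl⟩; exact hN i⟩
    obtain ⟨K, hK⟩ := Nat.sSup_mem (Set.range_nonempty f) hb
    exact ⟨K, fun l => hK ▸ le_csSup hb ⟨l, rfl⟩⟩
  exact ⟨K, fun l hl => le_antisymm (hK l) (hf hl)⟩

theorem tt_acc [Fintype Q] (A : NBW σ Q) {w : ℕ → σ} (hw : w ∉ A.Lang) :
    ∃ k, ∀ l, k ≤ l → ∀ q ∈ A.tt w l, q ∉ A.acc := by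
  obtain ⟨K, hK⟩ := ev_const (fun l => (A.tt w l).ncard)
    (monotone_nat_of_le_succ fun l => by
      show (A.tt w l).ncard ≤ (A.tt w (l+1)).ncard
      rw [← A.tt_image w l]
      exact Set.ncard_image_le (Set.toFinite _)) (Nat.card Q)
    (fun i => Set.ncard_le_card _)
  have hinj : ∀ l, K ≤ l → Set.InjOn (A.pw w l) (A.tt w (l + 1)) := by
    intro l hl
    apply Set.injOn_of_ncard_image_eq _ (Set.toFinite _)
    rw [A.tt_image w l]
    exact (hK l hl).trans (hK (l + 1) (by omega)).symm
  have hg : ∀ l q, q ∈ A.tt w l → ∃ x ∈ A.tt w (l + 1), A.pw w l x = q := by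
    intro l q hq
    rw [← A.tt_image w l] at hq
    exact hq
  choose! g hg1 hg2 using hg
  let path : Q → ℕ → Q := fun q i => Nat.rec q (fun i x => g (K + i) x) i
  have p0 : ∀ q, path q 0 = q := fun q => rfl
  have ps : ∀ q i, path q (i + 1) = g (K + i) (path q i) := fun q i => rfl
  have pm : ∀ q ∈ A.tt w K, ∀ i, path q i ∈ A.tt w (K + i) := by
    intro q hq i
    induction i with
    | zero => exact hq
    | succ i ih => rw [ps]; exact hg1 _ _ ih
  have pcov : ∀ i, ∀ x ∈ A.tt w (K + i), ∃ q ∈ A.tt w K, path q i = x := by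
    intro i
    induction i with
    | zero => exact fun x hx => ⟨x, hx, rfl⟩
    | succ i ih =>
      intro x hx
      have hpx : A.pw w (K + i) x ∈ A.tt w (K + i) := by
        rw [← A.tt_image w (K + i)]; exact ⟨x, hx, rfl⟩
      obtain ⟨q, hq, hqx⟩ := ih _ hpx
      refine ⟨q, hq, hinj (K + i) (by omega) (pm q hq (i + 1)) hx ?_⟩
      rw [ps, hg2 _ _ (pm q hq i), hqx]
  have hN : ∀ q, ∃ N, q ∈ A.tt w K → ∀ i, N ≤ i → path q i ∉ A.acc := by
    intro q
    by_contra hcon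
    push Not at hcon
    have hq := (hcon 0).1
    obtain ⟨η, hη, he⟩ := A.glue (A.tt_sub w K hq) (fun i => path q (i - K)) (by simp [p0]) (by
      intro i hi
      obtain ⟨j, rfl⟩ := Nat.exists_eq_add_of_le hi
      have e1 : K + j + 1 - K = j + 1 := by omega
      have e2 : K + j - K = j := by omega
      simp only [e1, e2]
      have := (A.pw_spec (A.tt_sub w (K + j + 1) (pm q hq (j + 1)))).2
      rwa [ps, hg2 _ _ (pm q hq j), ← ps] at this)
    refine hw ⟨η, hη, fun n => ?_⟩
    obtain ⟨_, i, hi, hi'⟩ := hcon n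
    refine ⟨K + i, by omega, ?_⟩
    rw [he _ (by omega)]
    simpa using hi'
  choose N hN using hN
  refine ⟨K + Finset.univ.sup N, fun l hl x hx => ?_⟩
  obtain ⟨i, rfl⟩ : ∃ i, l = K + i := ⟨l - K, by omega⟩
  obtain ⟨q, hq, rfl⟩ := pcov i x hx
  have : N q ≤ Finset.univ.sup N := Finset.le_sup (Finset.mem_univ q)
  exact hN q hq i (by omega)

theorem compl [Fintype Q] (A : NBW σ Q) {w : ℕ → σ} {k : ℕ} {C B : ℕ → Set Q}
    (hk : ∀ l, k ≤ l → ∀ q ∈ A.tt w l, q ∉ A.acc)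
    (hCk : C k = ∅) (hBC : ∀ l, k ≤ l → B l ⊆ C l) (hCS : ∀ l, k ≤ l → C l ⊆ A.rch w l)
    (hC : ∀ l, k ≤ l → C (l + 1) = {q | q ∈ A.rch w (l + 1) ∧ (A.pw w l q ∈ C l ∨ q ∈ A.acc)})
    (hB : ∀ l, k ≤ l → B (l + 1) = if B l = ∅ then C (l + 1) else
      {q | q ∈ A.rch w (l + 1) ∧ A.pw w l q ∈ B l}) :
    ∀ n, ∃ m, n ≤ m ∧ B m = ∅ := by
  by_contra hcon
  push Not at hcon
  obtain ⟨n, hn⟩ := hcon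
  have hCT : ∀ l, k ≤ l → ∀ q ∈ C l, q ∉ A.tt w l := by
    intro l hl
    induction l, hl using Nat.le_induction with
    | base => simp [hCk]
    | succ l hl ih =>
      intro q hq hqT
      rw [hC l hl] at hq
      rcases hq.2 with h | h
      · exact ih _ h (by rw [← A.tt_image w l]; exact ⟨q, hqT, rfl⟩)
      · exact hk _ (by omega) q hqT h
  have hne : ∀ l, n ≤ l → (B l).Nonempty := fun l hl => by
    have := hn l hl
    first | exact this | exact Set.nonempty_iff_ne_empty.2 this
  have key : ∀ j l, max n k ≤ l → (B l ∩ A.img w j l).Nonempty := by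
    intro j
    induction j with
    | zero =>
      intro l hl
      obtain ⟨x, hx⟩ := hne l (by omega)
      exact ⟨x, hx, hCS l (by omega) (hBC l (by omega) hx)⟩
    | succ j ih =>
      intro l hl
      obtain ⟨x, hx, hx'⟩ := ih (l + 1) (by omega)
      rw [hB l (by omega), if_neg (Set.nonempty_iff_ne_empty.1 (hne l (by omega)))] at hx
      exact ⟨_, hx.2, x, hx', rfl⟩
  obtain ⟨J, hJ⟩ := A.tt_stable w (max n k)
  obtain ⟨x, hx, hx'⟩ := key J (max n k) le_rfl
  exact hCT _ (by omega) x (hBC _ (by omega) hx) (hJ hx')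

/-- Deterministic-part states `(S, C, B)` with `B ⊆ C ⊆ S`. -/
structure DSt (Q : Type) where
  S : Set Q
  C : Set Q
  B : Set Q
  hCS : C ⊆ S
  hBC : B ⊆ C

/-- Encoding of a deterministic state by two sets. -/
def DSt.enc (d : DSt Q) : Set Q × Set Q := (d.C, d.B ∪ (d.S \ d.C))

theorem DSt.enc_inj : Function.Injective (DSt.enc : DSt Q → Set Q × Set Q) := by
  rintro ⟨S, C, B, h1, h2⟩ ⟨S', C', B', h1', h2'⟩ h
  simp only [DSt.enc, Prod.mk.injEq] at h
  obtain ⟨rfl, h⟩ := h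
  have hx : ∀ x, (x ∈ B ∨ x ∈ S ∧ x ∉ C) ↔ (x ∈ B' ∨ x ∈ S' ∧ x ∉ C) := fun x => by
    have := congrArg (fun s => x ∈ s) h
    simpa using this
  have e1 : S = S' := by
    ext x; have := hx x; have := @h1 x; have := @h2 x; have := @h1' x; have := @h2' x; tauto
  have e2 : B = B' := by
    ext x; have := hx x; have := @h1 x; have := @h2 x; have := @h1' x; have := @h2' x; tauto
  subst e1 e2
  rfl

/-- Deterministic step. -/
noncomputable def dstep (A : NBW σ Q) (d : DSt Q) (a : σ) : DSt Q where
  S := A.post d.S a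
  C := {q | q ∈ A.post d.S a ∧ (A.prd d.S a q ∈ d.C ∨ q ∈ A.acc)}
  B := if d.B = ∅ then {q | q ∈ A.post d.S a ∧ (A.prd d.S a q ∈ d.C ∨ q ∈ A.acc)} else
    {q | q ∈ A.post d.S a ∧ A.prd d.S a q ∈ d.B}
  hCS := fun _ h => h.1
  hBC := by
    split_ifs
    · exact subset_rfl
    · exact fun q h => ⟨h.1, Or.inl (d.hBC h.2)⟩

/-- Entry state. -/
def dent (S : Set Q) : DSt Q := ⟨S, ∅, ∅, Set.empty_subset _, subset_rfl⟩

/-- The complement automaton. -/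
noncomputable def cmpl (A : NBW σ Q) : NBW σ (Set Q ⊕ DSt Q) where
  init := {Sum.inl A.init}
  trans := fun s a => match s with
    | Sum.inl S => {Sum.inl (A.post S a), Sum.inr (dent (A.post S a))}
    | Sum.inr d => {Sum.inr (A.dstep d a)}
  acc := {s | ∃ d, s = Sum.inr d ∧ d.B = ∅}

theorem cmpl_limitDet (A : NBW σ Q) : A.cmpl.LimitDet := by
  refine ⟨Set.range Sum.inl, Set.range Sum.inr, ?_, ?_, ?_, ?_⟩
  · exact Set.isCompl_range_inl_range_inr.disjoint
  · exact Set.range_inl_union_range_inr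
  · rintro _ ⟨d, rfl, _⟩
    exact ⟨d, rfl⟩
  · rintro _ ⟨d, rfl⟩ a
    exact ⟨_, ⟨A.dstep d a, rfl⟩, rfl⟩

theorem cmpl_lang [Fintype Q] (A : NBW σ Q) (hfa : A.FinitelyAmbiguous) :
    A.cmpl.Lang = Set.univ \ A.Lang := by
  ext w
  simp only [Set.mem_diff, Set.mem_univ, true_and]
  constructor
  · rintro ⟨ρ, ⟨h0, h1⟩, h2⟩
    have h0 : ρ 0 = Sum.inl A.init := h0
    have hl : ∀ l S, ρ l = Sum.inl S → ρ (l + 1) = Sum.inl (A.post S (w l)) ∨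
        ρ (l + 1) = Sum.inr (dent (A.post S (w l))) := by
      intro l S h
      have := h1 l
      rw [h] at this
      exact this
    have hr : ∀ l d, ρ l = Sum.inr d → ρ (l + 1) = Sum.inr (A.dstep d (w l)) := by
      intro l d h
      have := h1 l
      rw [h] at this
      exact this
    -- every state carries the reachable set
    have hinv : ∀ l, ρ l = Sum.inl (A.rch w l) ∨ ∃ d, ρ l = Sum.inr d ∧ d.S = A.rch w l := by
      intro l
      induction l with
      | zero => exact Or.inl h0
      | succ l ih =>
        rcases ih with h | ⟨d, h, hd⟩
        · rcases hl l _ h with h' | h'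
          · exact Or.inl h'
          · exact Or.inr ⟨_, h', rfl⟩
        · exact Or.inr ⟨_, hr l d h, by rw [show (A.dstep d (w l)).S = A.post d.S (w l) from rfl, hd]; rfl⟩
    obtain ⟨k, -, dk, hdk, -⟩ := h2 0
    have hd : ∀ l, ∃ d : DSt Q, k ≤ l → ρ l = Sum.inr d := by
      intro l
      by_cases hkl : k ≤ l
      · induction l, hkl using Nat.le_induction with
        | base => exact ⟨dk, fun _ => hdk⟩
        | succ l hkl ih =>
          obtain ⟨d, hd⟩ := ih
          exact ⟨_, fun _ => hr l d (hd hkl)⟩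
      · exact ⟨dk, fun h => absurd h hkl⟩
    choose d hd using hd
    have hds : ∀ l, k ≤ l → d (l + 1) = A.dstep (d l) (w l) := by
      intro l hkl
      have := hr l _ (hd l hkl)
      rw [hd (l + 1) (by omega)] at this
      exact Sum.inr_injective this
    have hS : ∀ l, k ≤ l → (d l).S = A.rch w l := by
      intro l hkl
      rcases hinv l with h | ⟨d', h, h'⟩
      · rw [hd l hkl] at h; cases h
      · rw [hd l hkl] at h
        rw [Sum.inr_injective h, h']
    refine A.sound hfa (k := k) (C := fun l => (d l).C) (B := fun l => (d l).B) ?_ ?_ ?_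
    · intro l hkl
      simp only [hds l hkl, dstep, hS l hkl, pw, rch]
    · intro l hkl
      simp only [hds l hkl, dstep, hS l hkl, pw, rch]
    · intro n
      obtain ⟨m, hm, d', hd', hB'⟩ := h2 (max n k)
      refine ⟨m, by omega, ?_⟩
      rw [hd m (by omega)] at hd'
      rw [Sum.inr_injective hd']
      exact hB'
  · intro hw
    obtain ⟨k, hk⟩ := A.tt_acc hw
    let d : ℕ → DSt Q := fun i => Nat.rec (dent (A.rch w (k + 1)))
      (fun i x => A.dstep x (w (k + 1 + i))) i
    have d0 : d 0 = dent (A.rch w (k + 1)) := rfl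
    have ds : ∀ i, d (i + 1) = A.dstep (d i) (w (k + 1 + i)) := fun i => rfl
    have dS : ∀ i, (d i).S = A.rch w (k + 1 + i) := by
      intro i
      induction i with
      | zero => rfl
      | succ i ih =>
        rw [ds, show (A.dstep (d i) (w (k + 1 + i))).S = A.post (d i).S (w (k + 1 + i)) from rfl, ih]
        rfl
    have hinf := A.compl (w := w) (k := k + 1) (C := fun l => (d (l - (k + 1))).C)
      (B := fun l => (d (l - (k + 1))).B) (fun l hl => hk l (by omega))
      (by simp [d0, dent]) (fun l _ => (d _).hBC) (by
        intro l hl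
        have := (d (l - (k + 1))).hCS
        rw [dS] at this
        rwa [show k + 1 + (l - (k + 1)) = l by omega] at this) (by
        intro l hl
        obtain ⟨i, rfl⟩ := Nat.exists_eq_add_of_le hl
        have e1 : k + 1 + i + 1 - (k + 1) = i + 1 := by omega
        have e2 : k + 1 + i - (k + 1) = i := by omega
        simp only [e1, e2, ds, dstep, dS, pw, rch]) (by
        intro l hl
        obtain ⟨i, rfl⟩ := Nat.exists_eq_add_of_le hl
        have e1 : k + 1 + i + 1 - (k + 1) = i + 1 := by omega
        have e2 : k + 1 + i - (k + 1) = i := by omega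
        simp only [e1, e2, ds, dstep, dS, pw, rch])
    refine ⟨fun l => if l ≤ k then Sum.inl (A.rch w l) else Sum.inr (d (l - (k + 1))),
      ⟨?_, ?_⟩, ?_⟩
    · simp [cmpl, rch]
    · intro l
      rcases lt_trichotomy l k with h | rfl | h
      · have h' : l + 1 ≤ k := h
        simp only [h.le, h', if_true]
        exact Or.inl rfl
      · simp only [le_refl, if_true, show ¬ (l + 1 ≤ l) by omega, if_false, Nat.sub_self]
        exact Or.inr rfl
      · obtain ⟨i, rfl⟩ := Nat.exists_eq_add_of_lt h
        have e1 : k + i + 1 + 1 - (k + 1) = i + 1 := by omega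
        have e2 : k + i + 1 - (k + 1) = i := by omega
        simp only [show ¬ (k + i + 1 ≤ k) by omega, show ¬ (k + i + 1 + 1 ≤ k) by omega, if_false,
          e1, e2]
        rw [ds, show k + 1 + i = k + i + 1 by omega]
        exact rfl
    · intro n
      obtain ⟨m, hm, hB⟩ := hinf (max n (k + 1))
      refine ⟨m, by omega, ?_⟩
      simp only [show ¬ (m ≤ k) by omega, if_false]
      exact ⟨_, rfl, hB⟩

/-- Transport of an automaton along an equivalence of states. -/
def tr {P R : Type} (B : NBW σ P) (e : R ≃ P) : NBW σ R where
  init := e ⁻¹' B.init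
  trans := fun r a => e ⁻¹' B.trans (e r) a
  acc := e ⁻¹' B.acc

theorem tr_lang {P R : Type} (B : NBW σ P) (e : R ≃ P) : (B.tr e).Lang = B.Lang := by
  ext w
  constructor
  · rintro ⟨ρ, ⟨h0, h1⟩, h2⟩
    exact ⟨fun i => e (ρ i), ⟨h0, h1⟩, h2⟩
  · rintro ⟨ρ, ⟨h0, h1⟩, h2⟩
    refine ⟨fun i => e.symm (ρ i), ⟨by simpa [tr] using h0, fun i => by simpa [tr] using h1 i⟩,
      fun n => ?_⟩
    obtain ⟨m, hm, hm'⟩ := h2 n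
    exact ⟨m, hm, by simpa [tr] using hm'⟩

theorem tr_limitDet {P R : Type} (B : NBW σ P) (e : R ≃ P) (h : B.LimitDet) :
    (B.tr e).LimitDet := by
  obtain ⟨QN, QD, h1, h2, h3, h4⟩ := h
  refine ⟨e ⁻¹' QN, e ⁻¹' QD, h1.preimage e, ?_, Set.preimage_mono h3, ?_⟩
  · rw [← Set.preimage_union, h2, Set.preimage_univ]
  · intro q hq a
    obtain ⟨q', hq', ht⟩ := h4 (e q) hq a
    refine ⟨e.symm q', by simpa using hq', ?_⟩
    ext x
    simp [tr, ht, Equiv.eq_symm_apply]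

end NBW

/-- Every complete finitely ambiguous NBW with `n` states has a limit deterministic
complementary NBW with at most `2 ^ n + 4 ^ n` states. -/
theorem NBW.fanbw_complement_slice (σ Q : Type) [Fintype σ] [Nonempty σ] [Fintype Q]
    (A : NBW σ Q) (hc : A.Complete) (hfa : A.FinitelyAmbiguous) :
    ∃ (m : ℕ) (B : NBW σ (Fin m)), B.LimitDet ∧
      m ≤ 2 ^ Fintype.card Q + 4 ^ Fintype.card Q ∧
      B.Lang = Set.univ \ A.Lang := by
  haveI : Finite (NBW.DSt Q) := Finite.of_injective _ NBW.DSt.enc_inj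
  refine ⟨Nat.card (Set Q ⊕ NBW.DSt Q), A.cmpl.tr (Finite.equivFin _).symm,
    NBW.tr_limitDet _ _ A.cmpl_limitDet, ?_, ?_⟩
  · rw [Nat.card_sum]
    have h1 : Nat.card (Set Q) = 2 ^ Fintype.card Q := by
      rw [Nat.card_eq_fintype_card, Fintype.card_set]
    have h2 : Nat.card (NBW.DSt Q) ≤ Nat.card (Set Q × Set Q) :=
      Nat.card_le_card_of_injective _ NBW.DSt.enc_inj
    rw [Nat.card_prod, h1, ← mul_pow] at h2
    rw [h1]
    exact Nat.add_le_add_left h2 _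
  · rw [NBW.tr_lang, A.cmpl_lang hfa]
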